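/- Exponential mean-square stability of the semi-tamed Milstein scheme (Theorem 4.2): under Assumption 4.1, set h* = min( h₁, (2ρ−θ²)/(K² + (m²/4)(m²+m)β²) ) with h₁ = min( (2v−v̄)/(2Kv̄), 2v/((2K+v̄)v̄) ). For any N ∈ ℕ and T > 0 with h = T/N < h*, and any probability space carrying mutually independent ξ : Ω → ℝ^d with finite moments of all orders and ΔW_0, …, ΔW_{N−1} : Ω → ℝ^m each with law the m-fold product of the real Gaussian measure with mean 0 and variance h, the semi-tamed Milstein approximations Y_n satisfy E‖Y_n‖² ≤ E‖ξ‖²·exp(−γ_h·n·h) for all 0 ≤ n ≤ N, where γ_h = 2ρ − θ² − (K² + (m²/4)(m²+m)β²)·h > 0; moreover γ_h → 2ρ − θ² as h → 0. -/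

import Mathlib

open MeasureTheory ProbabilityTheory Real Finset
open scoped RealInnerProductSpace ENNReal NNReal

noncomputable section

abbrev Vec (n : ℕ) : Type := EuclideanSpace ℝ (Fin n)

/-- The `d × m` matrix with columns `g j x`, viewed as a continuous linear map `ℝ^m → ℝ^d`. -/
def Gclm {d m : ℕ} (g : Fin m → Vec d → Vec d) (x : Vec d) : Vec m →L[ℝ] Vec d :=
  LinearMap.toContinuousLinearMap
  { toFun := fun w => ∑ j, w j • g j x
    map_add' := by
      intro w w'
      simp [PiLp.add_apply, add_smul, Finset.sum_add_distrib]
    map_smul' := by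
      intro c w
      simp [PiLp.smul_apply, smul_smul, Finset.smul_sum] }

/-- `L^{j₁} g_{j₂} (x) = (Dg_{j₂})(x) · g_{j₁}(x)`. -/
def Lg {d m : ℕ} (g : Fin m → Vec d → Vec d) (j₁ j₂ : Fin m) (x : Vec d) : Vec d :=
  fderiv ℝ (g j₂) x (g j₁ x)

/-- One step of the semi-tamed Milstein scheme with stepsize `h`, drift parts `ph` (Lipschitz)
and `ps` (tamed), diffusion columns `g`, current state `y` and Brownian increment `w`. -/
def milstep {d m : ℕ} (h : ℝ) (ph ps : Vec d → Vec d) (g : Fin m → Vec d → Vec d)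
    (y : Vec d) (w : Vec m) : Vec d :=
  y + h • ph y + (h / (1 + ‖ps y‖ * h)) • ps y + Gclm g y w
    + (2⁻¹ : ℝ) • ∑ j₁, ∑ j₂, (w j₁ * w j₂ - (if j₁ = j₂ then h else 0)) • Lg g j₁ j₂ y

/-- The quantity `α` associated with a state `y` and an increment `w`. -/
def alph {d m : ℕ} (h : ℝ) (g : Fin m → Vec d → Vec d) (y : Vec d) (w : Vec m) : ℝ :=
  if 1 ≤ ‖y‖ then
    ⟪‖y‖⁻¹ • y, ‖y‖⁻¹ • (Gclm g y w)⟫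
      + ⟪‖y‖⁻¹ • y,
          (2 * ‖y‖)⁻¹ • ∑ j₁, ∑ j₂, (w j₁ * w j₂ - (if j₁ = j₂ then h else 0)) • Lg g j₁ j₂ y⟫
  else 0

/-- The constant `λ`. -/
def lamc {d m : ℕ} (T K : ℝ) (ph ps : Vec d → Vec d) (g : Fin m → Vec d → Vec d) : ℝ :=
  (1 + 4 * T * K + 2 * T * (‖ph 0‖ + ‖ps 0‖) + 2 * K + 2 * ‖Gclm g 0‖
    + (m : ℝ) ^ 2 * (T + 1) * (K + ⨆ j : Fin m × Fin m, ‖Lg g j.1 j.2 0‖)) ^ 2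

/-- The dominating process `D_n`, given `λ`, `‖ξ‖`, the squared increment norms and the `α`'s. -/
def Dproc (lam ξnorm : ℝ) (w2 al : ℕ → ℝ) (n : ℕ) : ℝ :=
  (lam + ξnorm) * Real.exp (lam +
    (Finset.range (n + 1)).sup' Finset.nonempty_range_add_one
      (fun u => ∑ k ∈ Finset.Ico u n, (lam * w2 k + al k)))

end

noncomputable section

lemma integral_pow_four_gaussianReal (s : ℝ≥0) :
    ∫ x, x ^ 4 ∂gaussianReal 0 s = 3 * (s : ℝ) ^ 2 := by
  have hexp : ∀ t : ℝ, HasDerivAt (fun t : ℝ => exp (s * t ^ 2 / 2))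
      (s * t * exp (s * t ^ 2 / 2)) t := by
    intro t
    have h := (((hasDerivAt_pow 2 t).const_mul (s : ℝ)).div_const 2).exp
    convert h using 1
    push_cast
    ring
  have hmgf : mgf id (gaussianReal 0 s) = fun t : ℝ => exp (s * t ^ 2 / 2) := by
    rw [mgf_id_gaussianReal]
    simp
  have key : iteratedDeriv 4 (fun t : ℝ => exp (s * t ^ 2 / 2)) 0 = 3 * (s : ℝ) ^ 2 := by
    have h1 : deriv (fun t : ℝ => exp (s * t ^ 2 / 2))
        = fun t : ℝ => s * t * exp (s * t ^ 2 / 2) := funext fun t => (hexp t).deriv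
    have h2 : deriv (fun t : ℝ => s * t * exp (s * t ^ 2 / 2))
        = fun t : ℝ => (s + s ^ 2 * t ^ 2) * exp (s * t ^ 2 / 2) := by
      funext t
      refine (((hasDerivAt_id' t).const_mul (s : ℝ)).mul (hexp t)).deriv.trans ?_
      ring
    have h3 : deriv (fun t : ℝ => ((s : ℝ) + s ^ 2 * t ^ 2) * exp (s * t ^ 2 / 2))
        = fun t : ℝ => (3 * s ^ 2 * t + s ^ 3 * t ^ 3) * exp (s * t ^ 2 / 2) := by
      funext t
      refine ((((hasDerivAt_pow 2 t).const_mul ((s : ℝ) ^ 2)).const_add (s : ℝ)).mul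
        (hexp t)).deriv.trans ?_
      push_cast
      ring
    have h4 : deriv (fun t : ℝ => (3 * (s : ℝ) ^ 2 * t + s ^ 3 * t ^ 3) * exp (s * t ^ 2 / 2)) 0
        = 3 * (s : ℝ) ^ 2 := by
      refine ((((hasDerivAt_id' (0 : ℝ)).const_mul (3 * (s : ℝ) ^ 2)).add
        ((hasDerivAt_pow 3 (0 : ℝ)).const_mul ((s : ℝ) ^ 3))).mul (hexp 0)).deriv.trans ?_
      simp
    simp only [iteratedDeriv_succ, iteratedDeriv_zero, h1, h2, h3, h4]
  have h := iteratedDeriv_mgf_zero (X := id) (μ := gaussianReal 0 s) (by simp) 4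
  rw [hmgf, key] at h
  simpa using h.symm

lemma integral_sq_gaussianReal (s : ℝ≥0) : ∫ x, x ^ 2 ∂gaussianReal 0 s = (s : ℝ) := by
  have h := variance_of_integral_eq_zero (X := fun x : ℝ => x) (μ := gaussianReal 0 s)
    (by fun_prop) (by simp)
  rw [← h, variance_fun_id_gaussianReal]

lemma integrable_pow_gaussianReal (s : ℝ≥0) (n : ℕ) :
    Integrable (fun x : ℝ => x ^ n) (gaussianReal 0 s) := by
  have h := (memLp_id_gaussianReal (μ := 0) (v := s) n).integrable_norm_pow'
  exact (integrable_norm_iff (by fun_prop)).1 (by simpa using h)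

section ProductGaussian

variable {m : ℕ} (s : ℝ≥0)

lemma integrable_pow_eval_pi_gaussianReal (i : Fin m) (n : ℕ) :
    Integrable (fun w : Fin m → ℝ => w i ^ n) (Measure.pi fun _ => gaussianReal 0 s) :=
  (measurePreserving_eval (fun _ : Fin m => gaussianReal 0 s) i).integrable_comp_of_integrable
    (integrable_pow_gaussianReal s n)

lemma integral_pow_eval_pi_gaussianReal (i : Fin m) (n : ℕ) :
    ∫ w : Fin m → ℝ, w i ^ n ∂(Measure.pi fun _ => gaussianReal 0 s)
      = ∫ x, x ^ n ∂gaussianReal 0 s :=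
  integral_comp_eval (μ := fun _ : Fin m => gaussianReal 0 s) (i := i) (f := fun x : ℝ => x ^ n)
    (by fun_prop)

lemma indepFun_pow_eval_pi_gaussianReal {i j : Fin m} (hij : i ≠ j) (n : ℕ) :
    IndepFun (fun w : Fin m → ℝ => w i ^ n) (fun w : Fin m → ℝ => w j ^ n)
      (Measure.pi fun _ => gaussianReal 0 s) :=
  (iIndepFun_pi (μ := fun _ : Fin m => gaussianReal 0 s) (X := fun _ x => x ^ n)
    (fun _ => by fun_prop)).indepFun hij

lemma integrable_eval_mul_eval_pow (i j : Fin m) (n : ℕ) :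
    Integrable (fun w : Fin m → ℝ => (w i * w j) ^ n) (Measure.pi fun _ => gaussianReal 0 s) := by
  by_cases hij : i = j
  · subst hij
    simpa [mul_pow, ← pow_add] using integrable_pow_eval_pi_gaussianReal s i (n + n)
  · simpa [mul_pow, Pi.mul_def] using (indepFun_pow_eval_pi_gaussianReal s hij n).integrable_mul
      (integrable_pow_eval_pi_gaussianReal s i n) (integrable_pow_eval_pi_gaussianReal s j n)

lemma integral_eval_mul_eval_pow_of_ne {i j : Fin m} (hij : i ≠ j) (n : ℕ) :
    ∫ w : Fin m → ℝ, (w i * w j) ^ n ∂(Measure.pi fun _ => gaussianReal 0 s)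
      = (∫ x, x ^ n ∂gaussianReal 0 s) ^ 2 := by
  simp_rw [mul_pow]
  rw [(indepFun_pow_eval_pi_gaussianReal s hij n).integral_fun_mul_eq_mul_integral
    (integrable_pow_eval_pi_gaussianReal s i n).1 (integrable_pow_eval_pi_gaussianReal s j n).1,
    integral_pow_eval_pi_gaussianReal,
    integral_pow_eval_pi_gaussianReal, sq]

lemma integral_eval_mul_eval (i j : Fin m) :
    ∫ w : Fin m → ℝ, w i * w j ∂(Measure.pi fun _ => gaussianReal 0 s)
      = if i = j then (s : ℝ) else 0 := by
  split_ifs with hij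
  · subst hij
    simp_rw [← sq]
    rw [integral_pow_eval_pi_gaussianReal, integral_sq_gaussianReal]
  · have h := integral_eval_mul_eval_pow_of_ne s hij 1
    simpa using h

/-- Variance of the quadratic monomials `w i * w j`. -/
lemma integral_sq_eval_mul_eval_sub (i j : Fin m) :
    ∫ w : Fin m → ℝ, (w i * w j - if i = j then (s : ℝ) else 0) ^ 2
        ∂(Measure.pi fun _ => gaussianReal 0 s)
      = (s : ℝ) ^ 2 + if i = j then (s : ℝ) ^ 2 else 0 := by
  split_ifs with hij
  · subst hij
    have h : ∀ w : Fin m → ℝ, (w i * w i - (s : ℝ)) ^ 2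
        = w i ^ 4 - 2 * s * w i ^ 2 + (s : ℝ) ^ 2 := fun w => by ring
    simp_rw [h]
    have h4 := integrable_pow_eval_pi_gaussianReal (m := m) s i 4
    have h2 := (integrable_pow_eval_pi_gaussianReal (m := m) s i 2).const_mul (2 * (s : ℝ))
    refine (integral_add (h4.sub h2) (integrable_const _)).trans ?_
    simp only [Pi.sub_apply]
    rw [integral_sub h4 h2, integral_const_mul,
      integral_pow_eval_pi_gaussianReal, integral_pow_eval_pi_gaussianReal,
      integral_pow_four_gaussianReal, integral_sq_gaussianReal]
    simp
    ring
  · simp only [sub_zero, add_zero]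
    rw [integral_eval_mul_eval_pow_of_ne s hij, integral_sq_gaussianReal]

lemma integrable_sq_eval_mul_eval_sub (i j : Fin m) (c : ℝ) :
    Integrable (fun w : Fin m → ℝ => (w i * w j - c) ^ 2)
      (Measure.pi fun _ => gaussianReal 0 s) := by
  have h : ∀ w : Fin m → ℝ, (w i * w j - c) ^ 2
      = (w i * w j) ^ 2 - 2 * c * (w i * w j) ^ 1 + c ^ 2 := fun w => by ring
  simp_rw [h]
  exact ((integrable_eval_mul_eval_pow s i j 2).sub
    ((integrable_eval_mul_eval_pow s i j 1).const_mul _)).add (integrable_const _)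

lemma map_neg_pi_gaussianReal :
    (Measure.pi fun _ : Fin m => gaussianReal 0 s).map (fun w => -w)
      = Measure.pi fun _ : Fin m => gaussianReal 0 s := by
  have h := Measure.pi_map_pi (μ := fun _ : Fin m => gaussianReal 0 s)
    (f := fun _ x => -x) (fun _ => by fun_prop)
  simp only [gaussianReal_map_neg, neg_zero] at h
  exact h

end ProductGaussian

lemma norm_sq_semi_tamed_drift_le {E : Type*} [NormedAddCommGroup E] [InnerProductSpace ℝ E]
    {K ρ v vb α h : ℝ} (hK : 0 ≤ K) (hvb : 0 ≤ vb) (hα : 1 < α) (hh : 0 < h)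
    (hlarge : vb + 2 * K * vb * h ≤ 2 * v) (hsmall : (2 * K + vb) * vb * h ≤ 2 * v)
    {y p q : E} (hyp : ⟪y, p⟫ ≤ -ρ * ‖y‖ ^ 2) (hp : ‖p‖ ≤ K * ‖y‖)
    (hyq : ⟪y, q⟫ ≤ -v * ‖y‖ ^ (α + 1)) (hq : ‖q‖ ≤ vb * ‖y‖ ^ α) :
    ‖y + h • p + (h / (1 + ‖q‖ * h)) • q‖ ^ 2
      ≤ (1 - 2 * ρ * h + K ^ 2 * h ^ 2) * ‖y‖ ^ 2 := by
  set t := h / (1 + ‖q‖ * h) with ht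
  have hqn := norm_nonneg q
  have hyn := norm_nonneg y
  have hden : 0 < 1 + ‖q‖ * h := by positivity
  have ht0 : 0 < t := by positivity
  have hth : t ≤ h := div_le_self hh.le (by nlinarith [mul_nonneg hqn hh.le])
  have htq : t * ‖q‖ ≤ 1 := by
    rw [ht, div_mul_eq_mul_div, div_le_one hden]
    linarith [mul_comm h ‖q‖]
  have hrpow : ‖y‖ ^ (α + 1) = ‖y‖ ^ α * ‖y‖ :=
    Real.rpow_add_one' hyn (by linarith)
  have hs : 0 ≤ ‖y‖ ^ (α + 1) := Real.rpow_nonneg hyn _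
  have hsα : 0 ≤ ‖y‖ ^ α := Real.rpow_nonneg hyn _
  have hpq : ⟪p, q⟫ ≤ K * vb * ‖y‖ ^ (α + 1) := by
    calc ⟪p, q⟫ ≤ ‖p‖ * ‖q‖ := real_inner_le_norm p q
      _ ≤ (K * ‖y‖) * (vb * ‖y‖ ^ α) := by gcongr
      _ = K * vb * ‖y‖ ^ (α + 1) := by rw [hrpow]; ring
  have htame : t * ‖q‖ ^ 2 + 2 * ⟪y, q⟫ + 2 * h * ⟪p, q⟫ ≤ 0 := by
    have hpq' := mul_le_mul_of_nonneg_left hpq hh.le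
    rcases le_total 1 ‖y‖ with hy | hy
    · have h1 : t * ‖q‖ ^ 2 ≤ vb * ‖y‖ ^ (α + 1) := by
        calc t * ‖q‖ ^ 2 = (t * ‖q‖) * ‖q‖ := by ring
          _ ≤ 1 * (vb * ‖y‖ ^ α) := by gcongr
          _ ≤ vb * ‖y‖ ^ (α + 1) := by
            rw [one_mul, hrpow]
            exact mul_le_mul_of_nonneg_left (le_mul_of_one_le_right hsα hy) hvb
      nlinarith [mul_le_mul_of_nonneg_right hlarge hs]
    · have h1 : t * ‖q‖ ^ 2 ≤ h * (vb ^ 2 * ‖y‖ ^ (α + 1)) := by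
        calc t * ‖q‖ ^ 2 ≤ h * (vb * ‖y‖ ^ α) ^ 2 := by gcongr
          _ = h * (vb ^ 2 * (‖y‖ ^ α * ‖y‖ ^ α)) := by ring
          _ ≤ h * (vb ^ 2 * (‖y‖ ^ α * ‖y‖)) := by
            gcongr
            simpa using Real.rpow_le_rpow_of_exponent_ge' hyn hy zero_le_one hα.le
          _ = h * (vb ^ 2 * ‖y‖ ^ (α + 1)) := by rw [hrpow]
      nlinarith [mul_le_mul_of_nonneg_right hsmall hs]
  have hexpand : ‖y + h • p + t • q‖ ^ 2 = ‖y‖ ^ 2 + 2 * h * ⟪y, p⟫ + h ^ 2 * ‖p‖ ^ 2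
      + t * (t * ‖q‖ ^ 2 + 2 * ⟪y, q⟫ + 2 * h * ⟪p, q⟫) := by
    rw [norm_add_sq_real, norm_add_sq_real, inner_add_left]
    simp only [real_inner_smul_left, real_inner_smul_right, norm_smul, mul_pow, Real.norm_eq_abs,
      sq_abs]
    ring
  have hp2 : ‖p‖ ^ 2 ≤ (K * ‖y‖) ^ 2 := by gcongr
  have h1 := mul_le_mul_of_nonneg_left hp2 (sq_nonneg h)
  have h2 := mul_le_mul_of_nonneg_left hyp hh.le
  have h3 := mul_nonpos_of_nonneg_of_nonpos ht0.le htame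
  rw [hexpand]
  nlinarith

lemma norm_sq_sum_smul_le {ι E : Type*} [Fintype ι] [NormedAddCommGroup E] [NormedSpace ℝ E]
    (c : ι → ℝ) (L : ι → E) {b : ℝ} (hL : ∀ i, ‖L i‖ ≤ b) :
    ‖∑ i, c i • L i‖ ^ 2 ≤ Fintype.card ι * b ^ 2 * ∑ i, c i ^ 2 := by
  calc ‖∑ i, c i • L i‖ ^ 2 ≤ (∑ i, |c i| * ‖L i‖) ^ 2 := by
        gcongr
        exact (norm_sum_le _ _).trans_eq (by simp [norm_smul])
    _ ≤ (∑ i, |c i| ^ 2) * ∑ i, ‖L i‖ ^ 2 := sum_mul_sq_le_sq_mul_sq _ _ _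
    _ ≤ (∑ i, |c i| ^ 2) * ∑ _i : ι, b ^ 2 := by
        gcongr with i
        exact hL i
    _ = Fintype.card ι * b ^ 2 * ∑ i, c i ^ 2 := by
        simp [sq_abs]
        ring

lemma lintegral_ofReal_le_of_map_neg {F : Type*} [MeasurableSpace F] [AddGroup F] [MeasurableNeg F]
    {μ : Measure F} (hμ : μ.map (fun w => -w) = μ) {f S : F → ℝ} (hf : Measurable f)
    (hf0 : ∀ w, 0 ≤ f w) (hS : Integrable S μ) (hfS : ∀ w, f w + f (-w) ≤ 2 * S w) :
    ∫⁻ w, ENNReal.ofReal (f w) ∂μ ≤ ENNReal.ofReal (∫ w, S w ∂μ) := by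
  have hneg : ∫⁻ w, ENNReal.ofReal (f (-w)) ∂μ = ∫⁻ w, ENNReal.ofReal (f w) ∂μ := by
    conv_rhs => rw [← hμ, lintegral_map (by fun_prop) measurable_neg]
  have hS0 : ∀ w, 0 ≤ S w := fun w => by linarith [hf0 w, hf0 (-w), hfS w]
  have h2 : 2 * ∫⁻ w, ENNReal.ofReal (f w) ∂μ ≤ 2 * ENNReal.ofReal (∫ w, S w ∂μ) := by
    rw [ofReal_integral_eq_lintegral_ofReal hS (Filter.Eventually.of_forall hS0),
      ← lintegral_const_mul' 2 (fun w => ENNReal.ofReal (S w)) (by simp),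
      two_mul (∫⁻ w, ENNReal.ofReal (f w) ∂μ)]
    nth_rewrite 2 [← hneg]
    rw [← lintegral_add_left (by fun_prop)]
    refine lintegral_mono fun w => ?_
    simp only
    rw [← ENNReal.ofReal_add (hf0 _) (hf0 _), ← ENNReal.ofReal_ofNat,
      ← ENNReal.ofReal_mul (by norm_num)]
    exact ENNReal.ofReal_le_ofReal (hfS w)
  exact (ENNReal.mul_le_mul_iff_right (by simp) (by simp)).1 h2

section Step

variable {d m : ℕ}

lemma Gclm_apply (g : Fin m → Vec d → Vec d) (x : Vec d) (w : Vec m) :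
    Gclm g x w = ∑ j, w j • g j x := rfl

lemma measurable_milstep {h : ℝ} {ph ps : Vec d → Vec d} {g : Fin m → Vec d → Vec d}
    (hph : Measurable ph) (hps : Measurable ps) (hg : ∀ j, Measurable (g j))
    (hL : ∀ i j, Measurable (Lg g i j)) :
    Measurable fun z : Vec d × Vec m => milstep h ph ps g z.1 z.2 := by
  simp only [milstep, Gclm_apply]
  have hw : ∀ j : Fin m, Measurable fun z : Vec d × Vec m => z.2 j := fun j => by fun_prop
  fun_prop

/-- Second moment of a deterministic vector `a` perturbed by a Milstein noise term. -/
lemma lintegral_norm_sq_add_noise_le {h : ℝ≥0} (a : Vec d) (G : Fin m → Vec d)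
    (L : Fin m → Fin m → Vec d) {b : ℝ} (hL : ∀ i j, ‖L i j‖ ≤ b) :
    ∫⁻ w, ENNReal.ofReal (‖a + ∑ j, w j • G j + (2⁻¹ : ℝ) •
        ∑ i, ∑ j, (w i * w j - if i = j then (h : ℝ) else 0) • L i j‖ ^ 2)
        ∂(Measure.pi fun _ : Fin m => gaussianReal 0 h)
      ≤ ENNReal.ofReal (‖a‖ ^ 2 + h * ∑ j, ‖G j‖ ^ 2
          + (m : ℝ) ^ 2 / 4 * ((m : ℝ) ^ 2 + m) * b ^ 2 * h ^ 2) := by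
  set c : Fin m → Fin m → (Fin m → ℝ) → ℝ :=
    fun i j w => w i * w j - if i = j then (h : ℝ) else 0 with hc
  set μ := Measure.pi fun _ : Fin m => gaussianReal 0 h with hμ
  have hprod : ∀ i j, Integrable (fun w : Fin m → ℝ => w i * w j) μ := fun i j => by
    simpa using integrable_eval_mul_eval_pow h i j 1
  have hcint : ∀ i j, Integrable (c i j) μ := fun i j => (hprod i j).sub (integrable_const _)
  have hc0 : ∀ i j, ∫ w, c i j w ∂μ = 0 := fun i j => by
    simp only [hc]
    rw [integral_sub (hprod i j) (integrable_const _), integral_eval_mul_eval]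
    simp
  have hc2int : ∀ i j, Integrable (fun w => c i j w ^ 2) μ := fun i j =>
    integrable_sq_eval_mul_eval_sub h i j _
  set S : (Fin m → ℝ) → ℝ := fun w => ‖a‖ ^ 2 + (∑ i, ∑ j, c i j w * ⟪a, L i j⟫)
    + (m : ℝ) ^ 2 / 4 * b ^ 2 * (∑ i, ∑ j, c i j w ^ 2)
    + ∑ i, ∑ j, (w i * w j) * ⟪G i, G j⟫ with hS
  have i1 : Integrable (fun w => ∑ i, ∑ j, c i j w * ⟪a, L i j⟫) μ :=
    integrable_finsetSum _ fun i _ => integrable_finsetSum _ fun j _ => (hcint i j).mul_const _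
  have i2 : Integrable (fun w => (m : ℝ) ^ 2 / 4 * b ^ 2 * ∑ i, ∑ j, c i j w ^ 2) μ :=
    (integrable_finsetSum _ fun i _ => integrable_finsetSum _ fun j _ => hc2int i j).const_mul _
  have i3 : Integrable (fun w => ∑ i, ∑ j, (w i * w j) * ⟪G i, G j⟫) μ :=
    integrable_finsetSum _ fun i _ => integrable_finsetSum _ fun j _ => (hprod i j).mul_const _
  have i0 : Integrable (fun _ : Fin m → ℝ => ‖a‖ ^ 2) μ := integrable_const _
  have hSint : Integrable S μ := ((i0.add i1).add i2).add i3
  have hSval : ∫ w, S w ∂μ = ‖a‖ ^ 2 + h * ∑ j, ‖G j‖ ^ 2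
      + (m : ℝ) ^ 2 / 4 * ((m : ℝ) ^ 2 + m) * b ^ 2 * h ^ 2 := by
    have e1 : ∫ w, (∑ i, ∑ j, c i j w * ⟪a, L i j⟫) ∂μ = 0 := by
      rw [integral_finsetSum _ fun i _ => integrable_finsetSum _ fun j _ =>
        (hcint i j).mul_const _]
      refine Finset.sum_eq_zero fun i _ => ?_
      rw [integral_finsetSum _ fun j _ => (hcint i j).mul_const _]
      refine Finset.sum_eq_zero fun j _ => ?_
      rw [integral_mul_const, hc0, zero_mul]
    have e2 : ∫ w, (∑ i, ∑ j, c i j w ^ 2) ∂μ = ((m : ℝ) ^ 2 + m) * h ^ 2 := by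
      rw [integral_finsetSum _ fun i _ => integrable_finsetSum _ fun j _ => hc2int i j]
      have : ∀ i, ∫ w, (∑ j, c i j w ^ 2) ∂μ = (m + 1 : ℝ) * h ^ 2 := fun i => by
        rw [integral_finsetSum _ fun j _ => hc2int i j]
        simp only [hc, hμ, integral_sq_eval_mul_eval_sub, Finset.sum_add_distrib]
        simp
        ring
      simp only [this]
      simp
      ring
    have e3 : ∫ w, (∑ i, ∑ j, (w i * w j) * ⟪G i, G j⟫) ∂μ = h * ∑ j, ‖G j‖ ^ 2 := by
      rw [integral_finsetSum _ fun i _ => integrable_finsetSum _ fun j _ =>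
        (hprod i j).mul_const _, Finset.mul_sum]
      refine Finset.sum_congr rfl fun i _ => ?_
      rw [integral_finsetSum _ fun j _ => (hprod i j).mul_const _]
      simp only [integral_mul_const, hμ, integral_eval_mul_eval]
      simp
    refine (integral_add ((i0.add i1).add i2) i3).trans ?_
    rw [integral_add' (i0.add i1) i2, integral_add' i0 i1, integral_const_mul, e1, e2, e3]
    simp
    ring
  rw [← hSval]
  refine lintegral_ofReal_le_of_map_neg (map_neg_pi_gaussianReal h) (by fun_prop)
    (fun w => by positivity) hSint fun w => ?_
  set B : Vec d := ∑ i, ∑ j, c i j w • L i j with hB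
  set Gw : Vec d := ∑ j, w j • G j with hGw
  have hBneg : ∑ i, ∑ j, ((-w) i * (-w) j - if i = j then (h : ℝ) else 0) • L i j = B := by
    simp [hB, hc]
  have hGneg : ∑ j, (-w) j • G j = -Gw := by simp [hGw]
  have hBnorm : ‖B‖ ^ 2 ≤ (m : ℝ) ^ 2 * b ^ 2 * ∑ i, ∑ j, c i j w ^ 2 := by
    have := norm_sq_sum_smul_le (fun z : Fin m × Fin m => c z.1 z.2 w) (fun z => L z.1 z.2)
      (fun z => hL z.1 z.2)
    simpa [Fintype.sum_prod_type, hB, sq] using this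
  have hainner : ⟪a, B⟫ = ∑ i, ∑ j, c i j w * ⟪a, L i j⟫ := by
    simp [hB, inner_sum, real_inner_smul_right]
  have hGnorm : ‖Gw‖ ^ 2 = ∑ i, ∑ j, (w i * w j) * ⟪G i, G j⟫ := by
    rw [← real_inner_self_eq_norm_sq, hGw]
    simp_rw [sum_inner, inner_sum, real_inner_smul_right, real_inner_smul_left]
    refine Finset.sum_congr rfl fun i _ => Finset.sum_congr rfl fun j _ => ?_
    ring
  simp only [hBneg, hGneg, hS, ← hGnorm, ← hainner]
  change ‖a + Gw + (2⁻¹ : ℝ) • B‖ ^ 2 + _ ≤ _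
  have hpar : ‖a + Gw + (2⁻¹ : ℝ) • B‖ ^ 2 + ‖a + -Gw + (2⁻¹ : ℝ) • B‖ ^ 2
      = 2 * (‖a‖ ^ 2 + ⟪a, B⟫ + 4⁻¹ * ‖B‖ ^ 2 + ‖Gw‖ ^ 2) := by
    simp only [norm_add_sq_real, inner_add_left, inner_neg_left, inner_neg_right,
      real_inner_smul_right, norm_smul, norm_neg, mul_pow, Real.norm_eq_abs, sq_abs]
    ring
  rw [hpar]
  linarith

lemma lintegral_norm_sq_milstep_le {h : ℝ} (hh : 0 ≤ h) {ph ps : Vec d → Vec d}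
    {g : Fin m → Vec d → Vec d} {y : Vec d} {b : ℝ} (hL : ∀ i j, ‖Lg g i j y‖ ≤ b) :
    ∫⁻ w, ENNReal.ofReal (‖milstep h ph ps g y w‖ ^ 2)
        ∂((Measure.pi fun _ : Fin m => gaussianReal 0 h.toNNReal).map (WithLp.toLp 2))
      ≤ ENNReal.ofReal (‖y + h • ph y + (h / (1 + ‖ps y‖ * h)) • ps y‖ ^ 2
          + h * ∑ j, ‖g j y‖ ^ 2 + (m : ℝ) ^ 2 / 4 * ((m : ℝ) ^ 2 + m) * b ^ 2 * h ^ 2) := by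
  have hnoise := lintegral_norm_sq_add_noise_le (h := h.toNNReal)
    (y + h • ph y + (h / (1 + ‖ps y‖ * h)) • ps y) (fun j => g j y) (fun i j => Lg g i j y) hL
  rw [Real.coe_toNNReal h hh] at hnoise
  simp only [milstep, Gclm_apply]
  rw [lintegral_map (by fun_prop) (by fun_prop)]
  exact hnoise

end Step

section Independence

variable {Ω : Type*} {mΩ : MeasurableSpace Ω} {P : Measure Ω}

lemma IndepFun.prodMk_left_of_indepFun_prodMk [IsProbabilityMeasure P] {A B C : Type*}
    [MeasurableSpace A] [MeasurableSpace B] [MeasurableSpace C] {a : Ω → A} {b : Ω → B} {c : Ω → C}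
    (ha : Measurable a) (hb : Measurable b) (hc : Measurable c)
    (habc : IndepFun a (fun ω => (b ω, c ω)) P) (hbc : IndepFun b c P) :
    IndepFun (fun ω => (a ω, b ω)) c P := by
  have hab : IndepFun a b P := habc.comp measurable_id measurable_fst
  have : IsProbabilityMeasure (P.map a) := Measure.isProbabilityMeasure_map ha.aemeasurable
  have : IsProbabilityMeasure (P.map b) := Measure.isProbabilityMeasure_map hb.aemeasurable
  have : IsProbabilityMeasure (P.map c) := Measure.isProbabilityMeasure_map hc.aemeasurable
  rw [indepFun_iff_map_prod_eq_prod_map_map (by fun_prop) (by fun_prop)] at habc hbc hab ⊢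
  rw [hbc, ← Measure.prodAssoc_prod] at habc
  rw [hab, (MeasurableEquiv.map_apply_eq_iff_map_symm_apply_eq _).1 habc.symm,
    Measure.map_map (MeasurableEquiv.measurable _) (by fun_prop)]
  rfl

lemma measurable_of_recursion {E F : Type*} [MeasurableSpace E] [MeasurableSpace F]
    {Φ : E × F → E} (hΦ : Measurable Φ) {W : ℕ → Ω → F} {Y : ℕ → Ω → E}
    (hW : ∀ k, Measurable (W k)) (hY0 : Measurable (Y 0))
    (hY : ∀ n ω, Y (n + 1) ω = Φ (Y n ω, W n ω)) (n : ℕ) : Measurable (Y n) := by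
  induction n with
  | zero => exact hY0
  | succ n ih =>
    rw [funext (hY n)]
    exact hΦ.comp (ih.prodMk (hW n))

/-- If `Y` is driven by `Y (n + 1) = Φ (Y n) (W n)`, with `Y 0` independent of the independent
sequence `W`, then `Y n` is independent of `W n`. -/
lemma indepFun_of_recursion [IsProbabilityMeasure P] {E F : Type*} [MeasurableSpace E]
    [MeasurableSpace F] [Inhabited F] {Φ : E × F → E} (hΦ : Measurable Φ) {ξ : Ω → E}
    {W : ℕ → Ω → F} {Y : ℕ → Ω → E} (hξ : Measurable ξ) (hW : ∀ k, Measurable (W k))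
    (hWi : iIndepFun W P) (hξW : IndepFun ξ (fun ω k => W k ω) P) (hY0 : ∀ ω, Y 0 ω = ξ ω)
    (hY : ∀ n ω, Y (n + 1) ω = Φ (Y n ω, W n ω)) (n : ℕ) :
    IndepFun (Y n) (W n) P := by
  let past : (ℕ → F) → ℕ → F := fun u k => if k < n then u k else default
  have hpast : Measurable past := measurable_pi_lambda _ fun k => by
    by_cases hk : k < n
    · simpa [past, hk] using measurable_pi_apply k
    · simp [past, hk]
  let sol : ℕ → E × (ℕ → F) → E :=
    fun k z => Nat.rec z.1 (fun k x => Φ (x, z.2 k)) k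
  have hsol : ∀ k, Measurable (sol k) := by
    intro k
    induction k with
    | zero => exact measurable_fst
    | succ k ih =>
      exact hΦ.comp (ih.prodMk ((measurable_pi_apply k).comp measurable_snd))
  have hYsol : ∀ k ≤ n, ∀ ω, Y k ω = sol k (ξ ω, past fun k => W k ω) := by
    intro k
    induction k with
    | zero => exact fun _ ω => hY0 ω
    | succ k ih =>
      intro hk ω
      have hpk : past (fun k => W k ω) k = W k ω := if_pos (by omega)
      change _ = Φ (sol k (ξ ω, past fun k => W k ω), past (fun k => W k ω) k)
      rw [hY, ih (by omega), hpk]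
  have hWpast : IndepFun (fun ω => past fun k => W k ω) (W n) P := by
    have h := hWi.indepFun_finset (Finset.range n) {n} (by simp) hW
    let ext : (Finset.range n → F) → ℕ → F :=
      fun u k => if hk : k ∈ Finset.range n then u ⟨k, hk⟩ else default
    have hext : Measurable ext := measurable_pi_lambda _ fun k => by
      by_cases hk : k ∈ Finset.range n
      · simp only [ext, hk, dif_pos]
        exact measurable_pi_apply _
      · simp only [ext, hk, dif_neg, not_false_eq_true]
        exact measurable_const
    have h' := h.comp hext (measurable_pi_apply (⟨n, by simp⟩ : ({n} : Finset ℕ)))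
    have hcomp : (fun ω => past fun k => W k ω) = ext ∘ fun ω (i : Finset.range n) => W i ω := by
      funext ω k
      by_cases hk : k < n <;> simp [past, ext, hk]
    rw [hcomp]
    exact h'
  have hξpast : IndepFun ξ (fun ω => (past fun k => W k ω, W n ω)) P :=
    hξW.comp measurable_id (hpast.prodMk (measurable_pi_apply n))
  have hWall : Measurable fun ω k => W k ω := measurable_pi_lambda _ hW
  have h := IndepFun.prodMk_left_of_indepFun_prodMk hξ (hpast.comp hWall) (hW n) hξpast hWpast
  rw [funext (hYsol n le_rfl)]
  exact h.comp (hsol n) measurable_id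

lemma lintegral_le_of_indepFun [IsProbabilityMeasure P] {E F : Type*} [MeasurableSpace E]
    [MeasurableSpace F] {X : Ω → E} {W : Ω → F} (hX : Measurable X) (hW : Measurable W)
    (hXW : IndepFun X W P) {f : E × F → ℝ≥0∞} (hf : Measurable f) {b : E → ℝ≥0∞}
    (hb : Measurable b) (hfb : ∀ x, ∫⁻ w, f (x, w) ∂(P.map W) ≤ b x) :
    ∫⁻ ω, f (X ω, W ω) ∂P ≤ ∫⁻ ω, b (X ω) ∂P := by
  have : IsProbabilityMeasure (P.map W) := Measure.isProbabilityMeasure_map hW.aemeasurable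
  rw [← lintegral_map (f := f) (g := fun ω => (X ω, W ω)) hf (hX.prodMk hW),
    hXW.map_prod_eq_prod_map_map hX.aemeasurable hW.aemeasurable,
    lintegral_prod _ hf.aemeasurable, ← lintegral_map hb hX]
  exact lintegral_mono hfb

end Independence

/-- Theorem 4.2: exponential mean-square stability of the semi-tamed Milstein scheme. -/
theorem exponential_mean_square_stability_semi_tamed_Milstein
    (d m : ℕ) (hd : 0 < d) (hm : 0 < m)
    (ph ps : Vec d → Vec d) (g : Fin m → Vec d → Vec d)
    (K ρ θ v vb β : ℝ) (α : ℝ)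
    (hK : 0 ≤ K) (hρ : 0 ≤ ρ) (hθ : 0 ≤ θ) (hv : 0 ≤ v) (hvb : 0 ≤ vb) (hβ : 0 ≤ β)
    (hα : 1 < α) (hρθ : θ ^ 2 < 2 * ρ) (hvvb : vb < 2 * v)
    (hph0 : ph 0 = 0) (hps0 : ps 0 = 0) (hg0 : ∀ j, g j 0 = 0)
    (hphC : ContDiff ℝ 1 ph) (hpsC : ContDiff ℝ 1 ps) (hgC : ∀ j, ContDiff ℝ 1 (g j))
    (hphm : ∀ x y : Vec d, ⟪x - y, ph x - ph y⟫ ≤ -ρ * ‖x - y‖ ^ 2)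
    (hphLip : ∀ x y : Vec d, ‖ph x - ph y‖ ≤ K * ‖x - y‖)
    (hpsm : ∀ x : Vec d, ⟪x, ps x⟫ ≤ -v * ‖x‖ ^ (α + 1))
    (hpsb : ∀ x : Vec d, ‖ps x‖ ≤ vb * ‖x‖ ^ α)
    (hgLip : ∀ x y : Vec d, Real.sqrt (∑ j, ‖g j x - g j y‖ ^ 2) ≤ θ * ‖x - y‖)
    (hLgLip : ∀ (i j : Fin m) (x y : Vec d), ‖Lg g j i x - Lg g j i y‖ ≤ β * ‖x - y‖)
    (N : ℕ) (hN : 0 < N) (T : ℝ) (hT : 0 < T)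
    (hh1 : 2 * K * vb ≠ 0 → T / N < (2 * v - vb) / (2 * K * vb))
    (hh2 : (2 * K + vb) * vb ≠ 0 → T / N < 2 * v / ((2 * K + vb) * vb))
    (hh3 : K ^ 2 + (m : ℝ) ^ 2 / 4 * ((m : ℝ) ^ 2 + m) * β ^ 2 ≠ 0 →
      T / N < (2 * ρ - θ ^ 2) / (K ^ 2 + (m : ℝ) ^ 2 / 4 * ((m : ℝ) ^ 2 + m) * β ^ 2))
    (Ω : Type) (mΩ : MeasurableSpace Ω) (P : Measure Ω) (hP : IsProbabilityMeasure P)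
    (ξ : Ω → Vec d) (ΔW : ℕ → Ω → Vec m) (Y : ℕ → Ω → Vec d)
    (hξmeas : Measurable ξ) (hWmeas : ∀ k, Measurable (ΔW k))
    (hξmom : ∀ r : ℕ, Integrable (fun ω => ‖ξ ω‖ ^ r) P)
    (hlaw : ∀ k, Measure.map (ΔW k) P
      = Measure.map (WithLp.toLp 2)
          (Measure.pi (fun _ : Fin m => gaussianReal 0 (Real.toNNReal (T / N)))))
    (hindep : iIndepFun ΔW P)
    (hindepξ : IndepFun ξ (fun ω k => ΔW k ω) P)
    (hY0 : ∀ ω, Y 0 ω = ξ ω)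
    (hYrec : ∀ n ω, Y (n + 1) ω = milstep (T / N) ph ps g (Y n ω) (ΔW n ω)) :
    (0 < 2 * ρ - θ ^ 2
        - (K ^ 2 + (m : ℝ) ^ 2 / 4 * ((m : ℝ) ^ 2 + m) * β ^ 2) * (T / N))
    ∧ (∀ n ≤ N, ∫⁻ ω, ENNReal.ofReal (‖Y n ω‖ ^ 2) ∂P
        ≤ ENNReal.ofReal (Real.exp (-(2 * ρ - θ ^ 2
              - (K ^ 2 + (m : ℝ) ^ 2 / 4 * ((m : ℝ) ^ 2 + m) * β ^ 2) * (T / N))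
            * n * (T / N)))
          * ∫⁻ ω, ENNReal.ofReal (‖ξ ω‖ ^ 2) ∂P)
    ∧ Filter.Tendsto
        (fun s : ℝ => 2 * ρ - θ ^ 2
          - (K ^ 2 + (m : ℝ) ^ 2 / 4 * ((m : ℝ) ^ 2 + m) * β ^ 2) * s)
        (nhdsWithin 0 (Set.Ioi 0)) (nhds (2 * ρ - θ ^ 2)) := by
  set h : ℝ := T / N with hh
  set C : ℝ := K ^ 2 + (m : ℝ) ^ 2 / 4 * ((m : ℝ) ^ 2 + m) * β ^ 2 with hC
  have hh0 : 0 < h := by positivity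
  have hC0 : 0 ≤ C := by positivity
  have hlarge : vb + 2 * K * vb * h ≤ 2 * v := by
    by_cases h0 : 2 * K * vb = 0
    · rw [h0]
      linarith
    · have := (lt_div_iff₀ (lt_of_le_of_ne (by positivity) (Ne.symm h0))).1 (hh1 h0)
      linarith
  have hsmall : (2 * K + vb) * vb * h ≤ 2 * v := by
    by_cases h0 : (2 * K + vb) * vb = 0
    · rw [h0]
      linarith
    · have := (lt_div_iff₀ (lt_of_le_of_ne (by positivity) (Ne.symm h0))).1 (hh2 h0)
      linarith
  have hγ : 0 < 2 * ρ - θ ^ 2 - C * h := by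
    by_cases h0 : C = 0
    · rw [h0]
      linarith
    · have := (lt_div_iff₀ (lt_of_le_of_ne hC0 (Ne.symm h0))).1 (hh3 h0)
      linarith
  refine ⟨hγ, ?_, ?_⟩
  swap
  · have hcont : Continuous fun s : ℝ => 2 * ρ - θ ^ 2 - C * s := by fun_prop
    exact (by simpa using hcont.tendsto 0 : Filter.Tendsto _ _ _).mono_left nhdsWithin_le_nhds
  set γ : ℝ := 2 * ρ - θ ^ 2 - C * h with hγdef
  have hLg0 : ∀ i j, Lg g i j 0 = 0 := fun i j => by simp [Lg, hg0]
  have hLgb : ∀ i j x, ‖Lg g i j x‖ ≤ β * ‖x‖ := fun i j x => by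
    simpa [hLg0] using hLgLip j i x 0
  have hgb : ∀ x, ∑ j, ‖g j x‖ ^ 2 ≤ θ ^ 2 * ‖x‖ ^ 2 := fun x => by
    have := (Real.sqrt_le_left (by positivity)).1 (hgLip x 0)
    simpa [hg0, mul_pow] using this
  have hLgmeas : ∀ i j, Measurable (Lg g i j) := fun i j =>
    (((hgC j).continuous_fderiv one_ne_zero).clm_apply (hgC i).continuous).measurable
  have hmeas : Measurable fun z : Vec d × Vec m => milstep h ph ps g z.1 z.2 :=
    measurable_milstep hphC.continuous.measurable hpsC.continuous.measurable
      (fun j => (hgC j).continuous.measurable) hLgmeas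
  have hYmeas : ∀ n, Measurable (Y n) :=
    measurable_of_recursion (Φ := fun z => milstep h ph ps g z.1 z.2) hmeas hWmeas
      (by simpa only [funext hY0] using hξmeas) hYrec
  have hstep : ∀ k y, ∫⁻ w, ENNReal.ofReal (‖milstep h ph ps g y w‖ ^ 2) ∂(P.map (ΔW k))
      ≤ ENNReal.ofReal (Real.exp (-γ * h)) * ENNReal.ofReal (‖y‖ ^ 2) := by
    intro k y
    rw [hlaw, ← ENNReal.ofReal_mul (by positivity)]
    refine (lintegral_norm_sq_milstep_le hh0.le fun i j => hLgb i j y).trans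
      (ENNReal.ofReal_le_ofReal ?_)
    have hdrift := norm_sq_semi_tamed_drift_le hK hvb hα hh0 hlarge hsmall
      (by simpa [hph0] using hphm y 0) (by simpa [hph0] using hphLip y 0) (hpsm y) (hpsb y)
    calc _ ≤ (1 - 2 * ρ * h + K ^ 2 * h ^ 2) * ‖y‖ ^ 2 + h * (θ ^ 2 * ‖y‖ ^ 2)
          + (m : ℝ) ^ 2 / 4 * ((m : ℝ) ^ 2 + m) * (β * ‖y‖) ^ 2 * h ^ 2 := by
          gcongr
          exact hgb y
      _ = (-γ * h + 1) * ‖y‖ ^ 2 := by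
          rw [hγdef, hC]
          ring
      _ ≤ Real.exp (-γ * h) * ‖y‖ ^ 2 := by
          gcongr
          exact Real.add_one_le_exp _
  suffices hall : ∀ n : ℕ, ∫⁻ ω, ENNReal.ofReal (‖Y n ω‖ ^ 2) ∂P
      ≤ ENNReal.ofReal (Real.exp (-γ * n * h)) * ∫⁻ ω, ENNReal.ofReal (‖ξ ω‖ ^ 2) ∂P from
    fun n _ => hall n
  intro n
  induction n with
  | zero => simp [hY0]
  | succ n ih =>
    have hind := indepFun_of_recursion (Φ := fun z => milstep h ph ps g z.1 z.2) hmeas hξmeas hWmeas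
      hindep hindepξ hY0 hYrec n
    have h1 := lintegral_le_of_indepFun (hYmeas n) (hWmeas n) hind
      (f := fun z => ENNReal.ofReal (‖milstep h ph ps g z.1 z.2‖ ^ 2)) (by fun_prop)
      (b := fun y => ENNReal.ofReal (Real.exp (-γ * h)) * ENNReal.ofReal (‖y‖ ^ 2))
      (by fun_prop) (hstep n)
    simp only [hYrec]
    refine h1.trans ?_
    rw [lintegral_const_mul' _ _ (by simp)]
    refine (mul_le_mul_right ih _).trans_eq ?_
    rw [← mul_assoc, ← ENNReal.ofReal_mul (by positivity), ← Real.exp_add]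
    congr 3
    push_cast
    ring
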